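/- For every infinitely differentiable function h : ℝ → ℝ, the factorization identity U(M₊(M₋ h)) = K(U h) holds at every point of ℝ. -/

import Mathlib

/-- Schrödinger-type operator `M f = -f'' + f + a·f`. -/
noncomputable def Mop (a f : ℝ → ℝ) (y : ℝ) : ℝ :=
  -(deriv (deriv f) y) + f y + a y * f y

/-- First-order factorization operator `U f = f' - (W₂'/W₂)·f`. -/
noncomputable def Uop (W₂ f : ℝ → ℝ) (y : ℝ) : ℝ :=
  deriv f y - (deriv W₂ y / W₂ y) * f y

/-- Fourth-order operator `K f = f'''' - 2f'' + K₂·f'' + K₁·f' + K₀·f + f`. -/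
noncomputable def Kop (K₂ K₁ K₀ f : ℝ → ℝ) (y : ℝ) : ℝ :=
  deriv (deriv (deriv (deriv f))) y - 2 * deriv (deriv f) y
    + K₂ y * deriv (deriv f) y + K₁ y * deriv f y + K₀ y * f y + f y

theorem ContDiff.deriv_top {f : ℝ → ℝ} (hf : ContDiff ℝ (⊤ : ℕ∞) f) :
    ContDiff ℝ (⊤ : ℕ∞) (deriv f) :=
  (contDiff_infty_iff_deriv.1 hf).2

theorem ContDiff.hasDerivAt_top {f : ℝ → ℝ} (hf : ContDiff ℝ (⊤ : ℕ∞) f) (x : ℝ) :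
    HasDerivAt f (deriv f x) x :=
  ((contDiff_infty_iff_deriv.1 hf).1 x).hasDerivAt

theorem deriv_eq_of_hasDerivAt {f f' : ℝ → ℝ} (h : ∀ x, HasDerivAt f (f' x) x) :
    deriv f = f' :=
  funext fun x => (h x).deriv

/-- If `W' = q·W`, then `(b·W)' = (b' + b·q)·W`. -/
theorem HasDerivAt.mul_of_logDeriv {b W : ℝ → ℝ} {b' q x : ℝ} (hb : HasDerivAt b b' x)
    (hW : HasDerivAt W (q * W x) x) :
    HasDerivAt (fun t => b t * W t) ((b' + b x * q) * W x) x :=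
  (hb.fun_mul hW).congr_deriv (by ring)

/-- The factorization identity in terms of `q = W₂'/W₂` and `r = λ·W₁/W₂`: then
`1 + a⁻ = r + q' + q²`, and `hE` is the equation `M₊W₁ = λ·W₂`. -/
theorem factorization_logDeriv {lam : ℝ} {a a₁ q q₁ q₂ q₃ q₄ r r₁ r₂ r₃ h h₁ h₂ h₃ h₄ h₅ : ℝ → ℝ}
    (ha : ∀ x, HasDerivAt a (a₁ x) x)
    (hq : ∀ x, HasDerivAt q (q₁ x) x) (hq₁ : ∀ x, HasDerivAt q₁ (q₂ x) x)
    (hq₂ : ∀ x, HasDerivAt q₂ (q₃ x) x) (hq₃ : ∀ x, HasDerivAt q₃ (q₄ x) x)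
    (hr : ∀ x, HasDerivAt r (r₁ x) x) (hr₁ : ∀ x, HasDerivAt r₁ (r₂ x) x)
    (hr₂ : ∀ x, HasDerivAt r₂ (r₃ x) x)
    (hh : ∀ x, HasDerivAt h (h₁ x) x) (hh₁ : ∀ x, HasDerivAt h₁ (h₂ x) x)
    (hh₂ : ∀ x, HasDerivAt h₂ (h₃ x) x) (hh₃ : ∀ x, HasDerivAt h₃ (h₄ x) x)
    (hh₄ : ∀ x, HasDerivAt h₄ (h₅ x) x)
    (hE : ∀ x, -(r₂ x + 2 * r₁ x * q x + r x * (q₁ x + q x ^ 2)) + (1 + a x) * r x = lam ^ 2)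
    {am W : ℝ → ℝ} (ham : ∀ x, am x = r x + q₁ x + q x ^ 2 - 1)
    (hWne : ∀ x, W x ≠ 0) (hW : ∀ x, deriv W x = q x * W x)
    {K₂ K₁ K₀ : ℝ → ℝ} {y : ℝ}
    (hK₂ : K₂ y = 1 - r y + 3 * (q₁ y + q y ^ 2) - 4 * q y ^ 2 - a y)
    (hK₁ : K₁ y = -3 * (r₁ y + r y * q y) + 3 * r y * q y
      + 3 * (q₂ y + 3 * q y * q₁ y + q y ^ 3) - 11 * q y * (q₁ y + q y ^ 2)
      + 8 * q y ^ 3 - a₁ y)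
    (hK₀ : K₀ y = -2 * (r₂ y + 2 * r₁ y * q y + r y * (q₁ y + q y ^ 2))
      + 5 * (r₁ y + r y * q y) * q y + 2 * q y ^ 2 - 3 * r y * q y ^ 2
      + r y * (q₁ y + q y ^ 2) - (q₁ y + q y ^ 2)
      + (q₃ y + 4 * q y * q₂ y + 3 * q₁ y ^ 2 + 6 * q y ^ 2 * q₁ y + q y ^ 4)
      - 5 * q y * (q₂ y + 3 * q y * q₁ y + q y ^ 3) - 3 * (q₁ y + q y ^ 2) ^ 2
      + 15 * (q₁ y + q y ^ 2) * q y ^ 2 - 8 * q y ^ 4 - a₁ y * q y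
      - a y * (q₁ y + q y ^ 2) + 2 * a y * q y ^ 2 + lam ^ 2 - 1) :
    Uop W (fun x => Mop a (fun t => Mop am h t) x) y = Kop K₂ K₁ K₀ (fun x => Uop W h x) y := by
  have hE' : -(r₃ y + 2 * r₂ y * q y + 2 * r₁ y * q₁ y + r₁ y * (q₁ y + q y ^ 2)
      + r y * (q₂ y + 2 * q y * q₁ y)) + a₁ y * r y + (1 + a y) * r₁ y = 0 := by
    have hd := (((hr₂ y).fun_add (((hr₁ y).const_mul 2).fun_mul (hq y))).fun_add
      ((hr y).fun_mul ((hq₁ y).fun_add ((hq y).fun_pow 2)))).fun_neg.fun_add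
        (((ha y).const_add 1).fun_mul (hr y))
    rw [funext hE] at hd
    have := hd.unique (hasDerivAt_const y (lam ^ 2))
    norm_num at this
    linear_combination this
  have hU : (fun x => Uop W h x) = fun x => h₁ x - q x * h x := by
    funext x
    have := hWne x
    rw [Uop, hW, (hh x).deriv]
    field_simp
  have hU₁ : deriv (fun x => h₁ x - q x * h x)
      = fun x => h₂ x - (q₁ x * h x + q x * h₁ x) :=
    deriv_eq_of_hasDerivAt fun x => (hh₁ x).fun_sub ((hq x).fun_mul (hh x))
  have hU₂ : deriv (fun x => h₂ x - (q₁ x * h x + q x * h₁ x))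
      = fun x => h₃ x - (q₂ x * h x + 2 * q₁ x * h₁ x + q x * h₂ x) :=
    deriv_eq_of_hasDerivAt fun x =>
      ((hh₂ x).fun_sub (((hq₁ x).fun_mul (hh x)).fun_add ((hq x).fun_mul (hh₁ x)))).congr_deriv
        (by ring)
  have hU₃ : deriv (fun x => h₃ x - (q₂ x * h x + 2 * q₁ x * h₁ x + q x * h₂ x))
      = fun x => h₄ x - (q₃ x * h x + 3 * q₂ x * h₁ x + 3 * q₁ x * h₂ x + q x * h₃ x) :=
    deriv_eq_of_hasDerivAt fun x =>
      ((hh₃ x).fun_sub ((((hq₂ x).fun_mul (hh x)).fun_add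
        (((hq₁ x).const_mul 2).fun_mul (hh₁ x))).fun_add ((hq x).fun_mul (hh₂ x)))).congr_deriv
        (by ring)
  have hU₄ : deriv (fun x => h₄ x -
        (q₃ x * h x + 3 * q₂ x * h₁ x + 3 * q₁ x * h₂ x + q x * h₃ x))
      = fun x => h₅ x - (q₄ x * h x + 4 * q₃ x * h₁ x + 6 * q₂ x * h₂ x + 4 * q₁ x * h₃ x
        + q x * h₄ x) :=
    deriv_eq_of_hasDerivAt fun x =>
      ((hh₄ x).fun_sub (((((hq₃ x).fun_mul (hh x)).fun_add
        (((hq₂ x).const_mul 3).fun_mul (hh₁ x))).fun_add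
        (((hq₁ x).const_mul 3).fun_mul (hh₂ x))).fun_add ((hq x).fun_mul (hh₃ x)))).congr_deriv
        (by ring)
  obtain ⟨p, hpdef⟩ : ∃ p : ℝ → ℝ, ∀ x, p x = r x + q₁ x + q x ^ 2 := ⟨_, fun _ => rfl⟩
  obtain ⟨p₁, hp₁def⟩ : ∃ p₁ : ℝ → ℝ, ∀ x, p₁ x = r₁ x + q₂ x + 2 * q x * q₁ x :=
    ⟨_, fun _ => rfl⟩
  obtain ⟨p₂, hp₂def⟩ : ∃ p₂ : ℝ → ℝ, ∀ x, p₂ x = r₂ x + q₃ x + 2 * q₁ x ^ 2 + 2 * q x * q₂ x :=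
    ⟨_, fun _ => rfl⟩
  have hp : ∀ x, HasDerivAt p (p₁ x) x := fun x => by
    rw [funext hpdef, hp₁def]
    exact (((hr x).fun_add (hq₁ x)).fun_add ((hq x).fun_pow 2)).congr_deriv (by norm_num)
  have hp₁ : ∀ x, HasDerivAt p₁ (p₂ x) x := fun x => by
    rw [funext hp₁def, hp₂def]
    exact (((hr₁ x).fun_add (hq₂ x)).fun_add
      (((hq x).const_mul 2).fun_mul (hq₁ x))).congr_deriv (by ring)
  have hp₂ : ∀ x, HasDerivAt p₂
      (r₃ x + q₄ x + 6 * q₁ x * q₂ x + 2 * q x * q₃ x) x := fun x => by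
    rw [funext hp₂def]
    exact ((((hr₂ x).fun_add (hq₃ x)).fun_add (((hq₁ x).fun_pow 2).const_mul 2)).fun_add
      (((hq x).const_mul 2).fun_mul (hq₂ x))).congr_deriv (by norm_num; ring)
  have hM : (fun x => Mop am h x) = fun x => -h₂ x + p x * h x := by
    funext x
    rw [Mop, deriv_eq_of_hasDerivAt hh, deriv_eq_of_hasDerivAt hh₁, ham, hpdef]
    ring
  have hM₀ : ∀ x, HasDerivAt (fun x => -h₂ x + p x * h x) (-h₃ x + (p₁ x * h x + p x * h₁ x)) x :=
    fun x => (hh₂ x).fun_neg.fun_add ((hp x).fun_mul (hh x))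
  have hM₁ : ∀ x, HasDerivAt (fun x => -h₃ x + (p₁ x * h x + p x * h₁ x))
      (-h₄ x + (p₂ x * h x + 2 * p₁ x * h₁ x + p x * h₂ x)) x := fun x =>
    ((hh₃ x).fun_neg.fun_add (((hp₁ x).fun_mul (hh x)).fun_add
      ((hp x).fun_mul (hh₁ x)))).congr_deriv (by ring)
  have hM₂ := (hh₄ y).fun_neg.fun_add ((((hp₂ y).fun_mul (hh y)).fun_add
      (((hp₁ y).const_mul 2).fun_mul (hh₁ y))).fun_add ((hp y).fun_mul (hh₂ y)))
  have hMM : (fun x => Mop a (fun x => -h₂ x + p x * h x) x) = fun x =>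
      -(-h₄ x + (p₂ x * h x + 2 * p₁ x * h₁ x + p x * h₂ x)) + (-h₂ x + p x * h x)
        + a x * (-h₂ x + p x * h x) := by
    funext x
    rw [Mop, deriv_eq_of_hasDerivAt hM₀, deriv_eq_of_hasDerivAt hM₁]
  have hq_div : deriv W y / W y = q y := by rw [hW, mul_div_cancel_right₀ _ (hWne y)]
  rw [hU, hM, hMM, Uop, Kop, hU₁, hU₂, hU₃, hU₄, hq_div,
    ((hM₂.fun_neg.fun_add (hM₀ y)).fun_add ((ha y).fun_mul (hM₀ y))).deriv]
  simp only [hpdef, hp₁def, hp₂def, hK₂, hK₁, hK₀]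
  linear_combination (h₁ y - q y * h y) * hE y + h y * hE'

theorem stmt2 (lam : ℝ) (ap am W₁ W₂ : ℝ → ℝ)
    (hap : ContDiff ℝ (⊤ : ℕ∞) ap) (ham : ContDiff ℝ (⊤ : ℕ∞) am)
    (hW₁ : ContDiff ℝ (⊤ : ℕ∞) W₁) (hW₂ : ContDiff ℝ (⊤ : ℕ∞) W₂)
    (hW₂ne : ∀ y, W₂ y ≠ 0)
    (hMp : ∀ y, Mop ap W₁ y = lam * W₂ y)
    (hMm : ∀ y, Mop am W₂ y = lam * W₁ y)
    (K₂ K₁ K₀ : ℝ → ℝ)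
    (hK₂ : ∀ y, K₂ y = 1 - lam * W₁ y / W₂ y + 3 * deriv (deriv W₂) y / W₂ y
      - 4 * (deriv W₂ y) ^ 2 / (W₂ y) ^ 2 - ap y)
    (hK₁ : ∀ y, K₁ y = -3 * lam * deriv W₁ y / W₂ y
      + 3 * lam * W₁ y * deriv W₂ y / (W₂ y) ^ 2
      + 3 * deriv (deriv (deriv W₂)) y / W₂ y
      - 11 * deriv W₂ y * deriv (deriv W₂) y / (W₂ y) ^ 2
      + 8 * (deriv W₂ y) ^ 3 / (W₂ y) ^ 3 - deriv ap y)
    (hK₀ : ∀ y, K₀ y = -2 * lam * deriv (deriv W₁) y / W₂ y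
      + 5 * lam * deriv W₁ y * deriv W₂ y / (W₂ y) ^ 2
      + 2 * (deriv W₂ y) ^ 2 / (W₂ y) ^ 2
      - 3 * lam * W₁ y * (deriv W₂ y) ^ 2 / (W₂ y) ^ 3
      + lam * W₁ y * deriv (deriv W₂) y / (W₂ y) ^ 2
      - deriv (deriv W₂) y / W₂ y
      + deriv (deriv (deriv (deriv W₂))) y / W₂ y
      - 5 * deriv W₂ y * deriv (deriv (deriv W₂)) y / (W₂ y) ^ 2
      - 3 * (deriv (deriv W₂) y) ^ 2 / (W₂ y) ^ 2
      + 15 * deriv (deriv W₂) y * (deriv W₂ y) ^ 2 / (W₂ y) ^ 3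
      - 8 * (deriv W₂ y) ^ 4 / (W₂ y) ^ 4
      - deriv ap y * deriv W₂ y / W₂ y
      - ap y * deriv (deriv W₂) y / W₂ y
      + 2 * ap y * (deriv W₂ y) ^ 2 / (W₂ y) ^ 2
      + lam ^ 2 - 1)
    (h : ℝ → ℝ) (hh : ContDiff ℝ (⊤ : ℕ∞) h) :
    ∀ y : ℝ, Uop W₂ (fun x => Mop ap (fun t => Mop am h t) x) y
      = Kop K₂ K₁ K₀ (fun x => Uop W₂ h x) y := by
  have hq : ContDiff ℝ (⊤ : ℕ∞) (fun x => deriv W₂ x / W₂ x) := hW₂.deriv_top.div hW₂ hW₂ne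
  have hr : ContDiff ℝ (⊤ : ℕ∞) (fun x => lam * W₁ x / W₂ x) :=
    (contDiff_const.mul hW₁).div hW₂ hW₂ne
  obtain ⟨q, hqdef⟩ : ∃ q : ℝ → ℝ, q = fun x => deriv W₂ x / W₂ x := ⟨_, rfl⟩
  obtain ⟨r, hrdef⟩ : ∃ r : ℝ → ℝ, r = fun x => lam * W₁ x / W₂ x := ⟨_, rfl⟩
  rw [← hqdef] at hq
  rw [← hrdef] at hr
  have hD := hq.hasDerivAt_top
  have hD₁ := hq.deriv_top.hasDerivAt_top
  have hD₂ := hq.deriv_top.deriv_top.hasDerivAt_top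
  have hR := hr.hasDerivAt_top
  have hR₁ := hr.deriv_top.hasDerivAt_top
  have w₁ : deriv W₂ = fun x => q x * W₂ x := by
    funext x
    rw [hqdef, div_mul_cancel₀ _ (hW₂ne x)]
  have hw : ∀ x, HasDerivAt W₂ (q x * W₂ x) x := fun x => by
    rw [← congrFun w₁ x]
    exact hW₂.hasDerivAt_top x
  have w₂ : deriv (deriv W₂) = fun x => (deriv q x + q x ^ 2) * W₂ x := by
    rw [w₁]
    exact deriv_eq_of_hasDerivAt fun x =>
      ((hD x).mul_of_logDeriv (hw x)).congr_deriv (by ring)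
  have w₃ : deriv (deriv (deriv W₂)) = fun x =>
      (deriv (deriv q) x + 3 * q x * deriv q x + q x ^ 3) * W₂ x := by
    rw [w₂]
    exact deriv_eq_of_hasDerivAt fun x =>
      (((hD₁ x).fun_add ((hD x).fun_pow 2)).mul_of_logDeriv (hw x)).congr_deriv
        (by push_cast; ring)
  have w₄ : deriv (deriv (deriv (deriv W₂))) = fun x =>
      (deriv (deriv (deriv q)) x + 4 * q x * deriv (deriv q) x + 3 * deriv q x ^ 2
        + 6 * q x ^ 2 * deriv q x + q x ^ 4) * W₂ x := by
    rw [w₃]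
    exact deriv_eq_of_hasDerivAt fun x =>
      ((((hD₂ x).fun_add (((hD x).const_mul 3).fun_mul (hD₁ x))).fun_add
        ((hD x).fun_pow 3)).mul_of_logDeriv (hw x)).congr_deriv (by push_cast; ring)
  have v₀ : ∀ x, lam * W₁ x = r x * W₂ x := fun x => by
    rw [hrdef, div_mul_cancel₀ _ (hW₂ne x)]
  have v₁ : ∀ x, lam * deriv W₁ x = (deriv r x + r x * q x) * W₂ x := fun x => by
    have hd := (hW₁.hasDerivAt_top x).const_mul lam
    rw [funext v₀] at hd
    exact hd.unique ((hR x).mul_of_logDeriv (hw x))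
  have v₂ : ∀ x, lam * deriv (deriv W₁) x
      = (deriv (deriv r) x + 2 * deriv r x * q x + r x * (deriv q x + q x ^ 2)) * W₂ x :=
    fun x => by
      have hd := (hW₁.deriv_top.hasDerivAt_top x).const_mul lam
      rw [funext v₁] at hd
      rw [hd.unique (((hR₁ x).fun_add ((hR x).fun_mul (hD x))).mul_of_logDeriv (hw x))]
      ring
  intro y
  have hy := hW₂ne y
  refine factorization_logDeriv (lam := lam) hap.hasDerivAt_top hD hD₁ hD₂
    hq.deriv_top.deriv_top.deriv_top.hasDerivAt_top hR hR₁ hr.deriv_top.deriv_top.hasDerivAt_top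
    hh.hasDerivAt_top hh.deriv_top.hasDerivAt_top hh.deriv_top.deriv_top.hasDerivAt_top
    hh.deriv_top.deriv_top.deriv_top.hasDerivAt_top
    hh.deriv_top.deriv_top.deriv_top.deriv_top.hasDerivAt_top
    (fun x => ?_) (fun x => ?_) hW₂ne (congrFun w₁) ?_ ?_ ?_
  · apply mul_right_cancel₀ (hW₂ne x)
    have := hMp x
    rw [Mop] at this
    linear_combination lam * this + v₂ x - (1 + ap x) * v₀ x
  · apply mul_right_cancel₀ (hW₂ne x)
    have := hMm x
    rw [Mop, w₂] at this
    linear_combination this + v₀ x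
  · rw [hK₂, v₀, w₂, w₁]
    field_simp
  · rw [hK₁, mul_assoc (-3) lam, mul_assoc 3 lam, v₀, v₁, w₃, w₂, w₁]
    field_simp
  · rw [hK₀, mul_assoc (-2) lam, mul_assoc 5 lam, mul_assoc 3 lam, v₀, v₁, v₂, w₄, w₃, w₂, w₁]
    field_simp
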